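/- Let n ≥ 1, r₁, r₂ > 0, and b₁, b₂ ∈ ℝⁿ. Then the open causal diamonds ◊(b₁, r₁) and ◊(b₂, r₂) are causally disjoint if and only if ‖b⃗₁ − b⃗₂‖ − |b₁₀ − b₂₀| ≥ r₁ + r₂. -/

import Mathlib

open Set Metric unitInterval

noncomputable section

/-- `n`-dimensional Minkowski space, modeled as `ℝⁿ` with the Euclidean norm. -/
abbrev Mink (n : ℕ) := EuclideanSpace ℝ (Fin n)

/-- The spatial part `x⃗ = (x 1, …, x (n-1)) ∈ ℝ^{n-1}` of `x ∈ ℝⁿ`. -/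
def spatial {n : ℕ} (x : Mink n) : Mink (n - 1) :=
  (WithLp.equiv 2 _).symm fun i : Fin (n - 1) => x ⟨i.1 + 1, by have := i.isLt; omega⟩

/-- A curve `γ` is future-directed causal if it is `C¹` and
`(γ₀)'(t) ≥ ‖(γ⃗)'(t)‖` for all `t ∈ [0,1]`. -/
def FDCausal {n : ℕ} [NeZero n] (γ : ℝ → Mink n) : Prop :=
  ContDiff ℝ 1 γ ∧
    ∀ t ∈ Set.Icc (0 : ℝ) 1,
      ‖deriv (fun s => spatial (γ s)) t‖ ≤ deriv (fun s => γ s 0) t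

/-- A curve `γ` is past-directed causal if it is `C¹` and
`-(γ₀)'(t) ≥ ‖(γ⃗)'(t)‖` for all `t ∈ [0,1]`. -/
def PDCausal {n : ℕ} [NeZero n] (γ : ℝ → Mink n) : Prop :=
  ContDiff ℝ 1 γ ∧
    ∀ t ∈ Set.Icc (0 : ℝ) 1,
      ‖deriv (fun s => spatial (γ s)) t‖ ≤ -(deriv (fun s => γ s 0) t)

/-- A causal curve is a future- or past-directed causal curve. -/
def IsCausalCurve {n : ℕ} [NeZero n] (γ : ℝ → Mink n) : Prop :=
  FDCausal γ ∨ PDCausal γ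

/-- `S` and `T` are causally disjoint if no causal curve starts in `S` and ends in `T`. -/
def CausallyDisjoint {n : ℕ} [NeZero n] (S T : Set (Mink n)) : Prop :=
  ¬ ∃ γ : ℝ → Mink n, IsCausalCurve γ ∧ γ 0 ∈ S ∧ γ 1 ∈ T

/-- The open causal diamond `◊(b, r) = {x : |x₀ - b₀| + ‖x⃗ - b⃗‖ < r}`. -/
def diamond {n : ℕ} [NeZero n] (b : Mink n) (r : ℝ) : Set (Mink n) :=
  {x | |x 0 - b 0| + ‖spatial x - spatial b‖ < r}

/-- The space `CDiam_n(k)` of `k` causally disjoint rectilinear causal diamonds in the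
standard diamond, recorded as tuples of (radius, center). -/
def CDiamSet (n : ℕ) [NeZero n] (k : ℕ) : Set (Fin k → ℝ × Mink n) :=
  {f | (∀ i, 0 < (f i).1 ∧ (f i).1 + |(f i).2 0| + ‖spatial (f i).2‖ ≤ 1) ∧
    ∀ i j, i ≠ j →
      CausallyDisjoint (diamond (f i).2 (f i).1) (diamond (f j).2 (f j).1)}

/-- The spatial projection as a continuous linear map. -/
def spatialCLM (n : ℕ) : Mink n →L[ℝ] Mink (n - 1) :=
  LinearMap.toContinuousLinearMap
    { toFun := spatial
      map_add' := fun _ _ => rfl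
      map_smul' := fun _ _ => rfl }

theorem spatial_add {n : ℕ} (x y : Mink n) : spatial (x + y) = spatial x + spatial y := rfl

theorem spatial_single_zero {n : ℕ} [NeZero n] (a : ℝ) :
    spatial (EuclideanSpace.single (0 : Fin n) a) = 0 := by
  ext i
  simp [spatial, Fin.ext_iff]

/-- A curve whose speed is bounded by the derivative of `B` on `[0,1]` has displacement at most
the increment of `B`. -/
theorem norm_sub_le_of_norm_deriv_le_deriv {E : Type*} [NormedAddCommGroup E] [NormedSpace ℝ E]
    {f : ℝ → E} {B : ℝ → ℝ} (hf : Differentiable ℝ f) (hB : Differentiable ℝ B)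
    (h : ∀ t ∈ Icc (0 : ℝ) 1, ‖deriv f t‖ ≤ deriv B t) : ‖f 1 - f 0‖ ≤ B 1 - B 0 := by
  refine image_norm_le_of_norm_deriv_right_le_deriv_boundary (a := 0) (b := 1)
    (f := fun t => f t - f 0) (f' := deriv f) (B := fun t => B t - B 0) (B' := deriv B)
    (hf.continuous.sub continuous_const).continuousOn
    (fun t _ => ((hf t).hasDerivAt.sub_const _).hasDerivWithinAt) (by simp)
    (fun t => (hB t).hasDerivAt.sub_const _)
    (fun t ht => h t (Ico_subset_Icc_self ht)) (right_mem_Icc.2 zero_le_one)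

theorem IsCausalCurve.norm_spatial_sub_le {n : ℕ} [NeZero n] {γ : ℝ → Mink n}
    (hγ : IsCausalCurve γ) : ‖spatial (γ 1) - spatial (γ 0)‖ ≤ |γ 1 0 - γ 0 0| := by
  have hd : Differentiable ℝ γ := by
    rcases hγ with h | h <;> exact h.1.differentiable one_ne_zero
  have hs : Differentiable ℝ fun s => spatial (γ s) := (spatialCLM n).differentiable.comp hd
  have h0 : Differentiable ℝ fun s => γ s 0 :=
    (EuclideanSpace.proj (𝕜 := ℝ) (0 : Fin n)).differentiable.comp hd
  rcases hγ with h | h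
  · exact (norm_sub_le_of_norm_deriv_le_deriv hs h0 h.2).trans (le_abs_self _)
  · have := norm_sub_le_of_norm_deriv_le_deriv hs h0.fun_neg
      (fun t ht => (h.2 t ht).trans_eq deriv.fun_neg.symm)
    exact this.trans (by linarith [neg_abs_le (γ 1 0 - γ 0 0)])

/-- The straight line between two points that are not spacelike separated is causal. -/
theorem exists_isCausalCurve {n : ℕ} [NeZero n] {x y : Mink n}
    (h : ‖spatial y - spatial x‖ ≤ |y 0 - x 0|) :
    ∃ γ : ℝ → Mink n, IsCausalCurve γ ∧ γ 0 = x ∧ γ 1 = y := by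
  have hγ (t : ℝ) : HasDerivAt (fun t : ℝ => x + t • (y - x)) (y - x) t := by
    simpa using ((hasDerivAt_id t).smul_const (y - x)).const_add x
  have hs (t : ℝ) : deriv (fun t : ℝ => spatial (x + t • (y - x))) t = spatial y - spatial x :=
    ((spatialCLM n).hasFDerivAt.comp_hasDerivAt t (hγ t)).deriv
  have h0 (t : ℝ) : deriv (fun t : ℝ => (x + t • (y - x)) 0) t = y 0 - x 0 :=
    ((EuclideanSpace.proj (𝕜 := ℝ) (0 : Fin n)).hasFDerivAt.comp_hasDerivAt t (hγ t)).deriv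
  have hC : ContDiff ℝ 1 fun t : ℝ => x + t • (y - x) := by fun_prop
  refine ⟨fun t => x + t • (y - x), ?_, by simp, by simp⟩
  rcases le_total 0 (y 0 - x 0) with hp | hp
  · exact Or.inl ⟨hC, fun t _ => by rw [hs, h0]; rwa [abs_of_nonneg hp] at h⟩
  · exact Or.inr ⟨hC, fun t _ => by rw [hs, h0]; rwa [abs_of_nonpos hp] at h⟩

theorem causallyDisjoint_iff {n : ℕ} [NeZero n] {S T : Set (Mink n)} :
    CausallyDisjoint S T ↔
      ∀ x ∈ S, ∀ y ∈ T, |y 0 - x 0| < ‖spatial y - spatial x‖ := by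
  constructor
  · intro hST x hx y hy
    by_contra! h
    obtain ⟨γ, hγ, rfl, rfl⟩ := exists_isCausalCurve h
    exact hST ⟨γ, hγ, hx, hy⟩
  · rintro h ⟨γ, hγ, h0, h1⟩
    exact (h _ h0 _ h1).not_ge hγ.norm_spatial_sub_le

theorem add_single_mem_diamond {n : ℕ} [NeZero n] {b : Mink n} {r a : ℝ} (h : |a| < r) :
    b + EuclideanSpace.single 0 a ∈ diamond b r := by
  simpa [diamond, spatial_add, spatial_single_zero] using h

/-- Two open causal diamonds are causally disjoint iff
`‖b⃗₁ - b⃗₂‖ - |b₁₀ - b₂₀| ≥ r₁ + r₂`. -/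
theorem causallyDisjoint_diamonds_iff (n : ℕ) [NeZero n] (hn : 1 ≤ n)
    (r₁ r₂ : ℝ) (hr₁ : 0 < r₁) (hr₂ : 0 < r₂) (b₁ b₂ : Mink n) :
    CausallyDisjoint (diamond b₁ r₁) (diamond b₂ r₂) ↔
      r₁ + r₂ ≤ ‖spatial b₁ - spatial b₂‖ - |b₁ 0 - b₂ 0| := by
  rw [causallyDisjoint_iff]
  constructor
  · intro h
    -- Moving the centres apart in time by `c * rᵢ` stays inside the diamonds for `c < 1`.
    have key (c : ℝ) (hc0 : 0 ≤ c) (hc1 : c < 1) :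
        c * (r₁ + r₂) ≤ ‖spatial b₁ - spatial b₂‖ - |b₁ 0 - b₂ 0| := by
      have h₁ : |c * r₁| < r₁ := by rw [abs_of_nonneg (by positivity)]; nlinarith
      have h₂ : |c * r₂| < r₂ := by rw [abs_of_nonneg (by positivity)]; nlinarith
      have hp := h _ (add_single_mem_diamond (b := b₁) (by rwa [abs_neg] : |-(c * r₁)| < r₁))
        _ (add_single_mem_diamond (b := b₂) h₂)
      have hm := h _ (add_single_mem_diamond (b := b₁) h₁)
        _ (add_single_mem_diamond (b := b₂) (by rwa [abs_neg] : |-(c * r₂)| < r₂))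
      simp only [spatial_add, spatial_single_zero, add_zero, PiLp.add_apply,
        PiLp.single_apply, if_true, norm_sub_rev (spatial b₂)] at hp hm
      have hp' := (abs_lt.1 hp).2
      have hm' := (abs_lt.1 hm).1
      rcases abs_cases (b₁ 0 - b₂ 0) with ⟨h, -⟩ | ⟨h, -⟩ <;> rw [h] <;> linarith
    have hr : 0 < r₁ + r₂ := add_pos hr₁ hr₂
    by_contra! hlt
    have h0 := key 0 le_rfl one_pos
    rw [zero_mul] at h0
    obtain ⟨c, hc, hc1⟩ := exists_between ((div_lt_one hr).2 hlt)
    exact ((div_lt_iff₀ hr).1 hc).not_ge (key c ((div_nonneg h0 hr.le).trans hc.le) hc1)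
  · intro h x hx y hy
    simp only [diamond, mem_ofPred_eq] at hx hy
    have hs : ‖spatial b₁ - spatial b₂‖ ≤
        ‖spatial x - spatial b₁‖ + ‖spatial y - spatial x‖ + ‖spatial y - spatial b₂‖ := by
      have := norm_add₃_le (a := spatial b₁ - spatial x) (b := spatial x - spatial y)
        (c := spatial y - spatial b₂)
      rw [norm_sub_rev (spatial b₁) (spatial x), norm_sub_rev (spatial x) (spatial y)] at this
      simpa using this
    have ht : |y 0 - x 0| ≤ |y 0 - b₂ 0| + |b₁ 0 - b₂ 0| + |x 0 - b₁ 0| := by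
      have := abs_add_three (y 0 - b₂ 0) (b₂ 0 - b₁ 0) (b₁ 0 - x 0)
      rw [abs_sub_comm (b₂ 0), abs_sub_comm (b₁ 0) (x 0)] at this
      simpa using this
    linarith
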